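/- Let $f : [0,L] \to \mathbb{R}$ be continuously differentiable with $\int_0^L f(t)\,dt = 0$. Then $\int_0^L f(t)^2\,dt \le \frac{L^2}{\pi^2}\int_0^L f'(t)^2\,dt$. -/

import Mathlib

open Real MeasureTheory intervalIntegral Set

/-- A Wirtinger inequality with a subcritical constant: the integrand `f'² / k² - f²` dominates the
derivative of a function vanishing at both endpoints. -/
theorem sq_mul_integral_sq_le_of_lt {L k : ℝ} (hL : 0 < L) (hk : 0 < k) (hkL : k * L < π)
    {f f' : ℝ → ℝ} (hf : ContinuousOn f (Icc 0 L)) (hf' : ContinuousOn f' (Icc 0 L))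
    (hderiv : ∀ x ∈ Ioo 0 L, HasDerivAt f (f' x) x) (hmean : ∫ t in (0:ℝ)..L, f t = 0) :
    k ^ 2 * ∫ t in (0:ℝ)..L, f t ^ 2 ≤ ∫ t in (0:ℝ)..L, f' t ^ 2 := by
  have hu : uIcc 0 L = Icc 0 L := uIcc_of_le hL.le
  set F : ℝ → ℝ := fun x => ∫ t in (0:ℝ)..x, f t
  have hFc : ContinuousOn F (Icc 0 L) := by
    rw [← hu]
    exact continuousOn_primitive_interval (hu ▸ hf.integrableOn_Icc)
  have hFd : ∀ x ∈ Ioo 0 L, HasDerivAt F (f x) x := fun x hx =>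
    integral_hasDerivAt_right
      ((hf.mono (Icc_subset_Icc_right hx.2.le)).intervalIntegrable_of_Icc hx.1.le)
      ((hf.mono Ioo_subset_Icc_self).stronglyMeasurableAtFilter isOpen_Ioo x hx)
      (hf.continuousAt (Icc_mem_nhds hx.1 hx.2))
  have hcos : ∀ x ∈ Icc 0 L, cos (k * (x - L / 2)) ≠ 0 := fun x hx =>
    (cos_pos_of_mem_Ioo ⟨by nlinarith [hx.1], by nlinarith [hx.2]⟩).ne'
  have key := sub_le_integral_of_hasDeriv_right_of_le hL.le
    (g := fun x => -2 * k ^ 2 * (f x * F x) - k ^ 3 * (F x ^ 2 * tan (k * (x - L / 2))))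
    (g' := fun x => -2 * k ^ 2 * (f' x * F x + f x * f x) -
      k ^ 3 * (2 * F x * f x * tan (k * (x - L / 2)) +
        F x ^ 2 * (k * (1 + tan (k * (x - L / 2)) ^ 2))))
    (φ := fun x => f' x ^ 2 - k ^ 2 * f x ^ 2) ?_ ?_ ?_ ?_
  · have hFL : F L = 0 := hmean
    have hF0 : F 0 = 0 := integral_same
    rw [integral_sub (f := fun x => f' x ^ 2) (g := fun x => k ^ 2 * f x ^ 2)
      ((hf'.pow 2).intervalIntegrable_of_Icc hL.le)
      (((hf.pow 2).const_smul (k ^ 2)).intervalIntegrable_of_Icc hL.le),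
      intervalIntegral.integral_const_mul] at key
    simp only [hFL, hF0] at key
    linarith
  · have htan : ContinuousOn (fun x => tan (k * (x - L / 2))) (Icc 0 L) := fun x hx =>
      (ContinuousAt.comp (g := tan) (f := fun x => k * (x - L / 2))
        (continuousAt_tan.2 (hcos x hx)) (by fun_prop)).continuousWithinAt
    fun_prop
  · intro x hx
    have hc := hcos x (Ioo_subset_Icc_self hx)
    have htan : HasDerivAt (fun x => tan (k * (x - L / 2)))
        (k * (1 + tan (k * (x - L / 2)) ^ 2)) x := by
      have hlin : HasDerivAt (fun x => k * (x - L / 2)) k x := by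
        simpa using ((hasDerivAt_id x).sub_const (L / 2)).const_mul k
      refine ((hasDerivAt_tan hc).comp x hlin).congr_deriv ?_
      rw [← inv_one_add_tan_sq hc]
      field_simp
    refine (((((hderiv x hx).mul (hFd x hx)).const_mul (-2 * k ^ 2)).sub
      ((((hFd x hx).pow 2).mul htan).const_mul (k ^ 3))).congr_deriv ?_).hasDerivWithinAt
    simp
  · exact ((hf'.pow 2).sub ((hf.pow 2).const_smul (k ^ 2))).integrableOn_Icc
  · intro x _
    nlinarith [sq_nonneg (f' x + k ^ 2 * F x),
      sq_nonneg (k * (f x + k * F x * tan (k * (x - L / 2))))]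

theorem stmt_10 (L : ℝ) (hL : 0 < L) (f : ℝ → ℝ)
    (hf : ContDiffOn ℝ 1 f (Icc 0 L)) (hmean : ∫ t in (0:ℝ)..L, f t = 0) :
    ∫ t in (0:ℝ)..L, (f t) ^ 2 ≤
      (L ^ 2 / π ^ 2) * ∫ t in (0:ℝ)..L, (derivWithin f (Icc 0 L) t) ^ 2 := by
  have hf' := hf.continuousOn_derivWithin (uniqueDiffOn_Icc hL) le_rfl
  have hderiv : ∀ x ∈ Ioo 0 L, HasDerivAt f (derivWithin f (Icc 0 L) x) x := fun x hx =>
    ((hf.differentiableOn one_ne_zero x (Ioo_subset_Icc_self hx)).hasDerivWithinAt).hasDerivAt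
      (Icc_mem_nhds hx.1 hx.2)
  have hlim : (π / L) ^ 2 * ∫ t in (0:ℝ)..L, f t ^ 2 ≤
      ∫ t in (0:ℝ)..L, derivWithin f (Icc 0 L) t ^ 2 := by
    have hcont : Continuous fun k : ℝ => k ^ 2 * ∫ t in (0:ℝ)..L, f t ^ 2 := by fun_prop
    refine le_of_tendsto (hcont.continuousWithinAt (s := Iio (π / L))) ?_
    filter_upwards [Ioo_mem_nhdsLT (div_pos pi_pos hL)] with k hk
    exact sq_mul_integral_sq_le_of_lt hL hk.1 ((lt_div_iff₀ hL).1 hk.2)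
      hf.continuousOn hf' hderiv hmean
  calc ∫ t in (0:ℝ)..L, f t ^ 2
      = L ^ 2 / π ^ 2 * ((π / L) ^ 2 * ∫ t in (0:ℝ)..L, f t ^ 2) := by
        field_simp
    _ ≤ _ := by gcongr
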